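/- Let α and β be finite types and let r : α → β → Prop be a relation (representing a bipartite graph with parts α and β and edges the pairs satisfying r). Define a matching of r as a finset S ⊆ α together with an injective function f : α → β such that r a (f a) holds for every a ∈ S; its size is |S|. Then the maximum size M of a matching of r satisfies M = |α| + min over all finsets X ⊆ α of (|Λ(X)| − |X|), where Λ(X) = {b : β | ∃ a ∈ X, r a b} and the minimum is taken over the integers (it is nonpositive, attained e.g. at X = ∅). -/

import Mathlib

/-- Hall's condition up to a deficiency `d` gives a partial matching missing at most `d` vertices. -/
theorem exists_embedding_of_card_le_ncard_add {α β : Type*} [Fintype α] [Fintype β]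
    (r : α → β → Prop) (d : ℕ)
    (h : ∀ X : Finset α, X.card ≤ ({b : β | ∃ a ∈ X, r a b} : Set β).ncard + d) :
    ∃ (S : Finset α) (f : S ↪ β), (∀ a : S, r a (f a)) ∧ Fintype.card α ≤ S.card + d := by
  classical
  let t : α → Finset (β ⊕ Fin d) := fun a => ({b | r a b} : Finset β).disjSum Finset.univ
  have ht : ∀ X : Finset α, X.card ≤ (X.biUnion t).card := by
    intro X
    rcases X.eq_empty_or_nonempty with rfl | ⟨x, hx⟩
    · simp
    have hU : X.biUnion t = ({b | ∃ a ∈ X, r a b} : Finset β).disjSum Finset.univ := by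
      ext (b | i)
      · simp [t]
      · simpa [t] using ⟨x, hx⟩
    have hX := h X
    rw [Set.ncard_eq_toFinset_card'] at hX
    simpa [hU, Set.toFinset_ofPred] using hX
  obtain ⟨g, hg, hgt⟩ := (Finset.all_card_le_biUnion_card_iff_exists_injective t).1 ht
  let S : Finset α := {a | (g a).isLeft}
  have hS : ∀ a : S, (g a).isLeft := fun a => (Finset.mem_filter.1 a.2).2
  have hgl : ∀ a : S, g a = Sum.inl ((g a).getLeft (hS a)) := fun a => by simp
  refine ⟨S, ⟨fun a => (g a).getLeft (hS a), fun a b hab => ?_⟩, fun a => ?_, ?_⟩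
  · exact Subtype.ext (hg ((hgl a).trans ((congrArg Sum.inl hab).trans (hgl b).symm)))
  · have ha := hgt a
    rw [hgl a] at ha
    exact (Finset.mem_filter.1 (Finset.inl_mem_disjSum.1 ha)).2
  · have hc : Sᶜ.card ≤ d := by
      have hsub : Sᶜ.image g ⊆ (Finset.univ : Finset (Fin d)).map Function.Embedding.inr := by
        intro y hy
        obtain ⟨a, ha, rfl⟩ := Finset.mem_image.1 hy
        cases hga : g a <;> simp_all [S]
      simpa [Finset.card_image_of_injective _ hg] using Finset.card_le_card hsub
    have := S.card_add_card_compl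
    omega

/-- A partial injection between finite types extends to an injection if cardinalities permit. -/
theorem exists_injective_extension {α β : Type*} [Fintype α] [Fintype β]
    (hc : Fintype.card α ≤ Fintype.card β) (S : Finset α) (f : S ↪ β) :
    ∃ g : α → β, Function.Injective g ∧ ∀ a : S, g a = f a := by
  classical
  rcases isEmpty_or_nonempty α with _ | ⟨⟨x⟩⟩
  · exact ⟨isEmptyElim, Function.injective_of_subsingleton _, fun a => isEmptyElim (a : α)⟩
  have : Nonempty β := Fintype.card_pos_iff.1 ((Fintype.card_pos_iff.2 ⟨x⟩).trans_le hc)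
  let e : α → β := Function.extend Subtype.val f fun _ => Classical.arbitrary β
  have he : ∀ a : S, e a = f a := fun a => Subtype.val_injective.extend_apply _ _ a
  have hinj : Set.InjOn e S := fun a ha b hb hab => by
    have hf : f ⟨a, ha⟩ = f ⟨b, hb⟩ := (he ⟨a, ha⟩).symm.trans (hab.trans (he ⟨b, hb⟩))
    exact congrArg Subtype.val (f.injective hf)
  obtain ⟨T, hT, hTc⟩ := Finset.exists_superset_card_eq
    (Finset.card_image_le.trans S.card_le_univ : (S.image e).card ≤ Fintype.card α) hc
  obtain ⟨g, hg⟩ := Finset.exists_equiv_extend_of_card_eq hTc.symm hT hinj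
  exact ⟨fun a => g a, Subtype.val_injective.comp g.injective,
    fun a => (hg a a.2).trans (he a)⟩

/-- The easy inequality of the Hall–Ore theorem. -/
theorem card_add_card_le_card_add_ncard {α β : Type*} [Fintype α] [Fintype β]
    {r : α → β → Prop} {S : Finset α} {f : α → β} (hf : Set.InjOn f S)
    (hr : ∀ a ∈ S, r a (f a)) (X : Finset α) :
    S.card + X.card ≤ Fintype.card α + ({b : β | ∃ a ∈ X, r a b} : Set β).ncard := by
  classical
  have hle : (S ∩ X).card ≤ ({b : β | ∃ a ∈ X, r a b} : Set β).ncard := by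
    rw [← Set.ncard_coe_finset]
    refine Set.ncard_le_ncard_of_injOn f (fun a ha => ?_)
      (hf.mono (Finset.coe_subset.2 Finset.inter_subset_left)) (Set.toFinite _)
    obtain ⟨haS, haX⟩ := Finset.mem_inter.1 (Finset.mem_coe.1 ha)
    exact ⟨a, haX, hr a haS⟩
  have hu := Finset.card_union_add_card_inter S X
  have := (S ∪ X).card_le_univ
  omega


/-- **Hall–Ore theorem (deficiency form).**
For a relation `r : α → β → Prop` between finite types (a bipartite graph with
parts `α` and `β`), a matching is a finset `S ⊆ α` together with an injective
`f : α → β` satisfying `r a (f a)` for all `a ∈ S`; its size is `|S|`.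
If `M` is the maximum size of a matching and `m` is the minimum over all
finsets `X ⊆ α` of `|Λ(X)| − |X|` (taken in `ℤ`), where
`Λ(X) = {b | ∃ a ∈ X, r a b}`, then `M = |α| + m`. -/
theorem hall_ore_deficiency {α β : Type*} [Fintype α] [Fintype β]
    (r : α → β → Prop) (M : ℕ) (m : ℤ)
    (hM : IsGreatest {n : ℕ | ∃ (S : Finset α) (f : α → β),
      Function.Injective f ∧ (∀ a ∈ S, r a (f a)) ∧ S.card = n} M)
    (hm : IsLeast {z : ℤ | ∃ X : Finset α,
      z = (({b : β | ∃ a ∈ X, r a b} : Set β).ncard : ℤ) - (X.card : ℤ)} m) :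
    (M : ℤ) = (Fintype.card α : ℤ) + m := by
  obtain ⟨⟨S, f, hf, hr, rfl⟩, hmax⟩ := hM
  obtain ⟨⟨X, rfl⟩, hmin⟩ := hm
  have hupper := card_add_card_le_card_add_ncard hf.injOn hr X
  have hnonpos := hmin ⟨∅, rfl⟩
  simp only [Finset.notMem_empty, false_and, exists_false, Set.ofPred_false, Set.ncard_empty,
    Finset.card_empty] at hnonpos
  obtain ⟨T, e, he, hT⟩ := exists_embedding_of_card_le_ncard_add r
    (X.card - ({b : β | ∃ a ∈ X, r a b} : Set β).ncard) fun Y => by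
      have := hmin ⟨Y, rfl⟩
      omega
  obtain ⟨g, hg, hge⟩ := exists_injective_extension (Fintype.card_le_of_injective f hf) T e
  have hTS : T.card ≤ S.card :=
    hmax ⟨T, g, hg, fun a ha => (hge ⟨a, ha⟩).symm ▸ he ⟨a, ha⟩, rfl⟩
  omega
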